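/- arXiv:1805.08380 — 5 statements merged into one kernel-verified Lean document; each statement's English description precedes it below -/
import Mathlib

section
/- Let ρ : ℝ^n → ℝ be smooth and strictly positive, and let Φ : ℝ^n → ℝ be smooth. Assume that div(ρ∇Φ)(x) = 0 for every x ∈ ℝ^n, that ∫_{ℝ^n} ρ(x)‖∇Φ(x)‖² dx < ∞, and that ∫_{ℝ^n} ρ(x)|Φ(x)|² dx < ∞. Then ∇Φ(x) = 0 for every x ∈ ℝ^n; in particular Φ is constant. -/
open MeasureTheory

/-- The divergence of a vector field on `ℝⁿ`: the sum of the partial derivatives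
`∂V_i/∂x_i`. -/
noncomputable def divergence {n : ℕ} (V : EuclideanSpace ℝ (Fin n) → EuclideanSpace ℝ (Fin n))
    (x : EuclideanSpace ℝ (Fin n)) : ℝ :=
  ∑ i, fderiv ℝ V x (EuclideanSpace.single i 1) i

/-- A divergence-free `C¹` field is orthogonal in `L²` to gradients of compactly supported `C¹`
functions. -/
theorem integral_fderiv_apply_eq_zero_of_divergence_eq_zero {n : ℕ}
    {V : EuclideanSpace ℝ (Fin n) → EuclideanSpace ℝ (Fin n)}
    {φ : EuclideanSpace ℝ (Fin n) → ℝ} (hV : ContDiff ℝ 1 V) (hφ : ContDiff ℝ 1 φ)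
    (hφc : HasCompactSupport φ) (hdiv : ∀ x, divergence V x = 0) :
    ∫ x, fderiv ℝ φ x (V x) = 0 := by
  have hVd : Differentiable ℝ V := hV.differentiable one_ne_zero
  have hVi (i : Fin n) : ContDiff ℝ 1 fun x => V x i := by fun_prop
  have hd (i : Fin n) (x v : EuclideanSpace ℝ (Fin n)) :
      fderiv ℝ (fun y => V y i) x v = fderiv ℝ V x v i := by
    have h := (EuclideanSpace.proj i : EuclideanSpace ℝ (Fin n) →L[ℝ] ℝ).hasFDerivAt.comp x
      (hVd x).hasFDerivAt
    exact congrArg (fun L => L v) h.fderiv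
  have hφ' : Continuous (fderiv ℝ φ) := hφ.continuous_fderiv one_ne_zero
  have int1 (i : Fin n) :
      Integrable fun x => fderiv ℝ φ x (EuclideanSpace.single i 1) * V x i :=
    Continuous.integrable_of_hasCompactSupport
      ((hφ'.clm_apply continuous_const).mul (hVi i).continuous)
      (hφc.fderiv_apply ℝ (EuclideanSpace.single i 1)).mul_right
  have int2 (i : Fin n) :
      Integrable fun x => φ x * fderiv ℝ (fun y => V y i) x (EuclideanSpace.single i 1) :=
    Continuous.integrable_of_hasCompactSupport
      (hφ.continuous.mul (((hVi i).continuous_fderiv one_ne_zero).clm_apply continuous_const))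
      hφc.mul_right
  have int3 (i : Fin n) : Integrable fun x => φ x * V x i :=
    Continuous.integrable_of_hasCompactSupport
      (hφ.continuous.mul (hVi i).continuous) hφc.mul_right
  have parts (i : Fin n) := integral_mul_fderiv_eq_neg_fderiv_mul_of_integrable
    (int1 i) (int2 i) (int3 i) (fun x _ => hφ.differentiable one_ne_zero x)
    (fun x _ => (hVi i).differentiable one_ne_zero x)
  have expand (x : EuclideanSpace ℝ (Fin n)) :
      fderiv ℝ φ x (V x) = ∑ i, fderiv ℝ φ x (EuclideanSpace.single i 1) * V x i := by
    conv_lhs => rw [← (EuclideanSpace.basisFun (Fin n) ℝ).sum_repr (V x)]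
    simp [mul_comm]
  calc ∫ x, fderiv ℝ φ x (V x)
      = ∑ i, ∫ x, fderiv ℝ φ x (EuclideanSpace.single i 1) * V x i := by
        simp_rw [expand]
        exact integral_finsetSum _ fun i _ => int1 i
    _ = -∑ i, ∫ x, φ x * fderiv ℝ (fun y => V y i) x (EuclideanSpace.single i 1) := by
        rw [← Finset.sum_neg_distrib]
        exact Finset.sum_congr rfl fun i _ => by rw [parts i, neg_neg]
    _ = -∫ x, φ x * divergence V x := by
        rw [← integral_finsetSum _ fun i _ => int2 i]
        simp_rw [hd, ← Finset.mul_sum]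
        rfl
    _ = 0 := by simp [hdiv]

/-- Smooth cutoffs, valued in `[0, 1]`, that converge pointwise to `1` and whose derivatives
converge uniformly to `0`. -/
theorem exists_cutoff_seq (E : Type*) [NormedAddCommGroup E] [NormedSpace ℝ E]
    [FiniteDimensional ℝ E] [HasContDiffBump E] :
    ∃ (η : ℕ → E → ℝ) (C : ℝ), (∀ k, ContDiff ℝ 1 (η k)) ∧ (∀ k, HasCompactSupport (η k)) ∧
      (∀ k x, ‖η k x‖ ≤ 1) ∧ (∀ x, ∀ᶠ k in Filter.atTop, η k x = 1) ∧
      ∀ k x, ‖fderiv ℝ (η k) x‖ ≤ C / (k + 1) := by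
  let χ : ContDiffBump (0 : E) := ⟨1, 2, one_pos, one_lt_two⟩
  have hχ : ContDiff ℝ 1 χ := χ.contDiff
  obtain ⟨C, hC⟩ := (χ.hasCompactSupport.fderiv ℝ).exists_bound_of_continuous
    (hχ.continuous_fderiv one_ne_zero)
  have hpos (k : ℕ) : (0 : ℝ) < k + 1 := by positivity
  refine ⟨fun k x => χ (((k : ℝ) + 1)⁻¹ • x), C, fun k => ?_, fun k => ?_, fun k x => ?_,
    fun x => ?_, fun k x => ?_⟩
  · exact hχ.comp (contDiff_const_smul _)
  · exact χ.hasCompactSupport.comp_smul (inv_ne_zero (hpos k).ne')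
  · rw [Real.norm_of_nonneg χ.nonneg]
    exact χ.le_one
  · obtain ⟨N, hN⟩ := exists_nat_ge ‖x‖
    filter_upwards [Filter.eventually_ge_atTop N] with k hk
    apply χ.one_of_mem_closedBall
    have hk' : (N : ℝ) ≤ k := by exact_mod_cast hk
    rw [mem_closedBall_zero_iff, norm_smul, norm_inv, Real.norm_of_nonneg (hpos k).le,
      inv_mul_le_iff₀ (hpos k)]
    change ‖x‖ ≤ (k + 1) * 1
    linarith
  · rw [fderiv_comp_smul, norm_smul, norm_inv, Real.norm_of_nonneg (hpos k).le, div_eq_inv_mul]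
    gcongr
    exact hC _


/-- Uniqueness for the homogeneous elliptic equation `∇·(ρ∇Φ) = 0` on `ℝⁿ` under
finite-energy conditions: the gradient of any solution vanishes identically. -/
theorem stmt0 {n : ℕ} (ρ Φ : EuclideanSpace ℝ (Fin n) → ℝ)
    (hρ : ContDiff ℝ (⊤ : ℕ∞) ρ) (hρpos : ∀ x, 0 < ρ x)
    (hΦ : ContDiff ℝ (⊤ : ℕ∞) Φ)
    (hdiv : ∀ x, divergence (fun y => ρ y • gradient Φ y) x = 0)
    (hE : Integrable (fun x => ρ x * ‖gradient Φ x‖ ^ 2))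
    (hL2 : Integrable (fun x => ρ x * |Φ x| ^ 2)) :
    (∀ x, gradient Φ x = 0) ∧ ∃ c : ℝ, ∀ x, Φ x = c := by
  have hΦ1 : ContDiff ℝ 1 Φ := hΦ.of_le (by exact_mod_cast le_top)
  have hΦd : Differentiable ℝ Φ := hΦ1.differentiable one_ne_zero
  have hgrad : ContDiff ℝ 1 (gradient Φ) :=
    (InnerProductSpace.toDual ℝ (EuclideanSpace ℝ (Fin n))).symm.contDiff.comp
      (hΦ.fderiv_right (m := 1) (by norm_cast))
  have hρ1 : ContDiff ℝ 1 ρ := hρ.of_le (by exact_mod_cast le_top)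
  have hV : ContDiff ℝ 1 fun y => ρ y • gradient Φ y := hρ1.smul hgrad
  have hself (x) : fderiv ℝ Φ x (gradient Φ x) = ‖gradient Φ x‖ ^ 2 := by
    rw [← real_inner_self_eq_norm_sq, gradient, InnerProductSpace.toDual_symm_apply]
  obtain ⟨η, C, hη, hηc, hη1, hηlim, hη'⟩ := exists_cutoff_seq (EuclideanSpace ℝ (Fin n))
  set f := fun x => ρ x * ‖gradient Φ x‖ ^ 2 with hf
  set g := fun x => ρ x * |Φ x| ^ 2 with hg
  have hfc : Continuous f := hρ.continuous.mul (hgrad.continuous.norm.pow 2)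
  have key (k : ℕ) : ‖∫ x, η k x * f x‖ ≤ C / (k + 1) * ∫ x, (f x + g x) := by
    have hzero := integral_fderiv_apply_eq_zero_of_divergence_eq_zero hV ((hη k).mul hΦ1)
      ((hηc k).mul_right (f' := Φ)) hdiv
    have hprod (x) : fderiv ℝ (η k * Φ) x (ρ x • gradient Φ x) =
        η k x * f x + Φ x * (ρ x * fderiv ℝ (η k) x (gradient Φ x)) := by
      rw [fderiv_mul ((hη k).differentiable one_ne_zero x) (hΦd x)]
      simp only [add_apply, smul_apply, map_smul, smul_eq_mul, hself, hf]
      ring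
    have int1 : Integrable fun x => η k x * f x :=
      ((hη k).continuous.mul hfc).integrable_of_hasCompactSupport (hηc k).mul_right
    have int2 : Integrable fun x => Φ x * (ρ x * fderiv ℝ (η k) x (gradient Φ x)) := by
      refine Continuous.integrable_of_hasCompactSupport ?_ ?_
      · exact hΦ.continuous.mul (hρ.continuous.mul
          (((hη k).continuous_fderiv one_ne_zero).clm_apply hgrad.continuous))
      · refine ((hηc k).fderiv ℝ).mono fun x hx => ?_
        contrapose! hx
        simp_all
    have hsum : ∫ x, η k x * f x = -∫ x, Φ x * (ρ x * fderiv ℝ (η k) x (gradient Φ x)) := by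
      change ∫ x, fderiv ℝ (η k * Φ) x (ρ x • gradient Φ x) = 0 at hzero
      simp_rw [hprod] at hzero
      rw [integral_add int1 int2] at hzero
      linarith
    rw [hsum, norm_neg, ← integral_const_mul]
    refine norm_integral_le_of_norm_le ((hE.add hL2).const_mul _) (.of_forall fun x => ?_)
    have hb := (fderiv ℝ (η k) x).le_of_opNorm_le (hη' k x) (gradient Φ x)
    have hC0 := (norm_nonneg _).trans (hη' k x)
    rw [norm_mul, norm_mul, Real.norm_of_nonneg (hρpos x).le]
    calc ‖Φ x‖ * (ρ x * ‖fderiv ℝ (η k) x (gradient Φ x)‖)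
        ≤ |Φ x| * (ρ x * (C / (k + 1) * ‖gradient Φ x‖)) := by
          have := (hρpos x).le
          rw [Real.norm_eq_abs]
          gcongr
      _ = C / (k + 1) * (ρ x * (|Φ x| * ‖gradient Φ x‖)) := by ring
      _ ≤ C / (k + 1) * (ρ x * (‖gradient Φ x‖ ^ 2 + |Φ x| ^ 2)) := by
          have := (hρpos x).le
          gcongr
          nlinarith [sq_nonneg (|Φ x| - ‖gradient Φ x‖), sq_nonneg (|Φ x|),
            sq_nonneg ‖gradient Φ x‖]
      _ = C / (k + 1) * (f x + g x) := by simp only [hf, hg]; ring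
  have lim1 : Filter.Tendsto (fun k => ∫ x, η k x * f x) Filter.atTop (nhds (∫ x, f x)) := by
    refine tendsto_integral_of_dominated_convergence (fun x => ‖f x‖)
      (fun k => ((hη k).continuous.mul hfc).aestronglyMeasurable) hE.norm
      (fun k => .of_forall fun x => ?_) (.of_forall fun x => ?_)
    · rw [norm_mul]
      exact mul_le_of_le_one_left (norm_nonneg _) (hη1 k x)
    · refine tendsto_const_nhds.congr' ?_
      filter_upwards [hηlim x] with k hk
      rw [hk, one_mul]
  have lim2 : Filter.Tendsto (fun k => ∫ x, η k x * f x) Filter.atTop (nhds 0) := by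
    refine squeeze_zero_norm key ?_
    simpa [div_eq_mul_inv] using
      ((tendsto_one_div_add_atTop_nhds_zero_nat (𝕜 := ℝ)).const_mul C).mul_const
        (∫ x, (f x + g x))
  have hf0 : f = 0 := by
    have hnn : 0 ≤ f := fun x => mul_nonneg (hρpos x).le (sq_nonneg _)
    have h := (integral_eq_zero_iff_of_nonneg hnn hE).1 (tendsto_nhds_unique lim1 lim2)
    exact (hfc.ae_eq_iff_eq volume continuous_zero).1 h
  have hgrad0 (x) : gradient Φ x = 0 := by
    have h : ρ x * ‖gradient Φ x‖ ^ 2 = 0 := congrFun hf0 x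
    simpa [(hρpos x).ne'] using h
  refine ⟨hgrad0, Φ 0, fun x => is_const_of_fderiv_eq_zero hΦd (fun y => ?_) x 0⟩
  simpa [gradient] using hgrad0 y
end

section
/- Let ρ : ℝ → ℝ be continuous and strictly positive, let g₁, g₂ : ℝ → ℝ be integrable, and define G_i(x) := ∫_{−∞}^x g_i(y) dy for i = 1,2. Suppose Φ₁, Φ₂ : ℝ → ℝ are differentiable, that for each i the function x ↦ ρ(x)Φ_i'(x) is differentiable with derivative equal to −g_i(x) at every x, and that ρ(x)Φ_i'(x) → 0 as x → −∞. Then ρ(x)Φ_i'(x) = −G_i(x) for every x ∈ ℝ, hence ρ(x)Φ₁'(x)Φ₂'(x) = G₁(x)G₂(x)/ρ(x) pointwise, and consequently ∫_ℝ ρ(x)Φ₁'(x)Φ₂'(x) dx = ∫_ℝ G₁(x)G₂(x)/ρ(x) dx. -/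
open MeasureTheory Filter

/-- A function vanishing at `-∞` whose derivative is the negative of an integrable function `g`
is the negative of the cumulative integral of `g`. -/
theorem eq_neg_integral_Iic_of_hasDerivAt_neg {f g : ℝ → ℝ} (hg : Integrable g)
    (hf : ∀ x, HasDerivAt f (-g x) x) (hlim : Tendsto f atBot (nhds 0)) (x : ℝ) :
    f x = -(∫ y in Set.Iic x, g y) := by
  have h := integral_Iic_of_hasDerivAt_of_tendsto' (a := x) (fun y _ => hf y)
    hg.neg.integrableOn hlim
  rw [integral_neg, sub_zero] at h
  exact h.symm

/-- Explicit formula for the 1D Wasserstein metric tensor: if `(ρΦᵢ')' = −gᵢ` with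
`ρΦᵢ' → 0` at `−∞` and `Gᵢ(x) = ∫_{−∞}^x gᵢ`, then `ρΦᵢ' = −Gᵢ` pointwise, hence
`ρΦ₁'Φ₂' = G₁G₂/ρ` pointwise and `∫ ρΦ₁'Φ₂' = ∫ G₁G₂/ρ`. -/
theorem stmt8 (ρ g₁ g₂ Φ₁ Φ₂ Φ₁' Φ₂' : ℝ → ℝ)
    (hρc : Continuous ρ) (hρpos : ∀ x, 0 < ρ x)
    (hg₁ : Integrable g₁) (hg₂ : Integrable g₂)
    (hΦ₁ : ∀ x, HasDerivAt Φ₁ (Φ₁' x) x) (hΦ₂ : ∀ x, HasDerivAt Φ₂ (Φ₂' x) x)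
    (hd₁ : ∀ x, HasDerivAt (fun y => ρ y * Φ₁' y) (-g₁ x) x)
    (hd₂ : ∀ x, HasDerivAt (fun y => ρ y * Φ₂' y) (-g₂ x) x)
    (hlim₁ : Tendsto (fun x => ρ x * Φ₁' x) atBot (nhds 0))
    (hlim₂ : Tendsto (fun x => ρ x * Φ₂' x) atBot (nhds 0)) :
    (∀ x, ρ x * Φ₁' x = -(∫ y in Set.Iic x, g₁ y)) ∧
    (∀ x, ρ x * Φ₂' x = -(∫ y in Set.Iic x, g₂ y)) ∧
    (∀ x, ρ x * Φ₁' x * Φ₂' x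
        = (∫ y in Set.Iic x, g₁ y) * (∫ y in Set.Iic x, g₂ y) / ρ x) ∧
    ∫ x, ρ x * Φ₁' x * Φ₂' x
      = ∫ x, (∫ y in Set.Iic x, g₁ y) * (∫ y in Set.Iic x, g₂ y) / ρ x := by
  have h₁ := eq_neg_integral_Iic_of_hasDerivAt_neg hg₁ hd₁ hlim₁
  have h₂ := eq_neg_integral_Iic_of_hasDerivAt_neg hg₂ hd₂ hlim₂
  have h₃ : ∀ x, ρ x * Φ₁' x * Φ₂' x
      = (∫ y in Set.Iic x, g₁ y) * (∫ y in Set.Iic x, g₂ y) / ρ x := by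
    intro x
    rw [eq_div_iff (hρpos x).ne', ← neg_mul_neg (∫ y in Set.Iic x, g₁ y), ← h₁ x, ← h₂ x]
    ring
  exact ⟨h₁, h₂, h₃, integral_congr_ae (ae_of_all _ h₃)⟩
end

section
/- Let [a,b] be a compact interval and Θ ⊂ ℝ^d open. Let ρ : [a,b] × Θ → ℝ be continuous, with ρ(·,θ) strictly positive and ∫_a^b ρ(x,θ) dx = 1 for each θ, and set F(x,θ) := ∫_a^x ρ(y,θ) dy. Let ρ* : [a,b] → ℝ be continuous and strictly positive with ∫_a^b ρ*(y) dy = 1 and cumulative distribution function F*, and define T(x,θ) := (F*)⁻¹(F(x,θ)) and R(θ) := (1/2)∫_a^b (x − T(x,θ))² ρ(x,θ) dx. Fix θ ∈ Θ and an index i. Assume: (i) for every x ∈ [a,b], ∂ρ/∂θ_i(x,θ) exists and ∂F/∂θ_i(x,θ) = ∫_a^x ∂ρ/∂θ_i(y,θ) dy; (ii) ∂T/∂θ_i(x,θ) = ∂F/∂θ_i(x,θ)/ρ*(T(x,θ)) for every x; (iii) T(·,θ) is differentiable in x with ρ*(T(x,θ))·∂T/∂x(x,θ) = ρ(x,θ);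 (iv) differentiation under the integral sign is valid, i.e. ∂R/∂θ_i(θ) = ∫_a^b ∂/∂θ_i [ (1/2)(x − T(x,θ))² ρ(x,θ) ] dx. Then ∂R/∂θ_i(θ) = − ∫_a^b (x − T(x,θ)) ∂F/∂θ_i(x,θ) dx. -/
open MeasureTheory

/-- Integration by parts against the primitive of a merely integrable function. -/
theorem integral_mul_eq_sub_integral_deriv_mul_primitive {a b : ℝ} (hab : a ≤ b)
    {u u' v : ℝ → ℝ} (hu : ∀ x ∈ Set.Icc a b, HasDerivWithinAt u (u' x) (Set.Icc a b) x)
    (hu' : IntervalIntegrable u' volume a b) (hv : IntervalIntegrable v volume a b) :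
    ∫ x in a..b, u x * v x =
      u b * (∫ y in a..b, v y) - ∫ x in a..b, u' x * ∫ y in a..x, v y := by
  have huc : ContinuousOn u (Set.Icc a b) := fun x hx => (hu x hx).continuousWithinAt
  have hprim : ∀ x ∈ Set.Icc a b, ∫ y in a..x, u' y = u x - u a := by
    intro x hx
    refine intervalIntegral.integral_eq_sub_of_hasDerivAt_of_le hx.1
      (huc.mono (Set.Icc_subset_Icc_right hx.2)) (fun y hy => ?_) (hu'.mono_set ?_)
    · exact (hu y ⟨hy.1.le, hy.2.le.trans hx.2⟩).hasDerivAt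
        (Icc_mem_nhds hy.1 (hy.2.trans_le hx.2))
    · rw [Set.uIcc_of_le hab, Set.uIcc_of_le hx.1]
      exact Set.Icc_subset_Icc_right hx.2
  have hparts := AbsolutelyContinuousOnInterval.integral_mul_deriv_eq_deriv_mul
    (hu'.absolutelyContinuousOnInterval_intervalIntegral (c := a) Set.left_mem_uIcc)
    (hv.absolutelyContinuousOnInterval_intervalIntegral (c := a) Set.left_mem_uIcc)
  have hleft : ∫ x in a..b, (∫ y in a..x, u' y) * deriv (fun x => ∫ y in a..x, v y) x =
      ∫ x in a..b, (u x * v x - u a * v x) := by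
    refine intervalIntegral.integral_congr_ae ?_
    filter_upwards [hv.ae_hasDerivAt_integral] with x hx hxm
    have hxm' := Set.uIoc_subset_uIcc hxm
    rw [(hx hxm' a Set.left_mem_uIcc).deriv, hprim x (by rwa [Set.uIcc_of_le hab] at hxm'), sub_mul]
  have hright : ∫ x in a..b, deriv (fun x => ∫ y in a..x, u' y) x * (∫ y in a..x, v y) =
      ∫ x in a..b, u' x * ∫ y in a..x, v y := by
    refine intervalIntegral.integral_congr_ae ?_
    filter_upwards [hu'.ae_hasDerivAt_integral] with x hx hxm
    rw [(hx (Set.uIoc_subset_uIcc hxm) a Set.left_mem_uIcc).deriv]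
  rw [hleft, hright, hprim b ⟨hab, le_rfl⟩, intervalIntegral.integral_sub
    (hv.continuousOn_mul (by rwa [Set.uIcc_of_le hab])) (hv.const_mul _),
    intervalIntegral.integral_const_mul, intervalIntegral.integral_same] at hparts
  linarith

/-- The quantile transform of a level in `[0, 1]` lies in the support interval. -/
theorem invFunOn_primitive_mem_Icc {a b : ℝ} (hab : a ≤ b) {f G : ℝ → ℝ}
    (hf : IntervalIntegrable f volume a b) (hf1 : ∫ y in a..b, f y = 1)
    (hG : ∀ y, G y = ∫ z in a..y, f z) {p : ℝ} (hp : p ∈ Set.Icc (0 : ℝ) 1) :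
    Function.invFunOn G (Set.Icc a b) p ∈ Set.Icc a b := by
  have hGc : ContinuousOn G (Set.Icc a b) := by
    rw [funext hG, ← Set.uIcc_of_le hab]
    exact intervalIntegral.continuousOn_primitive_interval' hf Set.left_mem_uIcc
  have hsub := intermediate_value_Icc hab hGc
  rw [hG a, hG b, intervalIntegral.integral_same, hf1] at hsub
  exact Function.invFunOn_mem (hsub hp)

/-- First derivative of the 1D squared-Wasserstein objective
`R(θ) = ½∫ₐᵇ (x − T(x,θ))² ρ(x,θ) dx`:
under (i)–(iv), `∂R/∂θᵢ(θ) = −∫ₐᵇ (x − T(x,θ)) ∂F/∂θᵢ(x,θ) dx`. -/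
theorem stmt11 {d : ℕ} (a b : ℝ) (hab : a < b)
    (Θ : Set (Fin d → ℝ)) (hΘ : IsOpen Θ)
    (ρ : ℝ → (Fin d → ℝ) → ℝ)
    (hρc : ContinuousOn (fun p : ℝ × (Fin d → ℝ) => ρ p.1 p.2) (Set.Icc a b ×ˢ Θ))
    (hρpos : ∀ θ ∈ Θ, ∀ x ∈ Set.Icc a b, 0 < ρ x θ)
    (hρ1 : ∀ θ ∈ Θ, ∫ x in a..b, ρ x θ = 1)
    (ρs : ℝ → ℝ) (hρsc : ContinuousOn ρs (Set.Icc a b))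
    (hρspos : ∀ y ∈ Set.Icc a b, 0 < ρs y)
    (hρs1 : ∫ y in a..b, ρs y = 1)
    (F : ℝ → (Fin d → ℝ) → ℝ) (hF : ∀ x θ, F x θ = ∫ y in a..x, ρ y θ)
    (Fs : ℝ → ℝ) (hFs : ∀ y, Fs y = ∫ z in a..y, ρs z)
    (T : ℝ → (Fin d → ℝ) → ℝ)
    (hT : ∀ x θ, T x θ = Function.invFunOn Fs (Set.Icc a b) (F x θ))
    (R : (Fin d → ℝ) → ℝ)
    (hR : ∀ θ, R θ = (1/2) * ∫ x in a..b, (x - T x θ)^2 * ρ x θ)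
    (θ : Fin d → ℝ) (hθ : θ ∈ Θ) (i : Fin d)
    (ρi Fi Ti Tx : ℝ → ℝ)
    (hρiInt : IntervalIntegrable ρi volume a b)
    -- (i): `∂ρ/∂θᵢ(x,θ)` exists and `∂F/∂θᵢ(x,θ) = ∫ₐˣ ∂ρ/∂θᵢ(y,θ) dy`
    (hi : ∀ x ∈ Set.Icc a b,
      HasDerivAt (fun s => ρ x (Function.update θ i s)) (ρi x) (θ i) ∧
      HasDerivAt (fun s => F x (Function.update θ i s)) (Fi x) (θ i) ∧
      Fi x = ∫ y in a..x, ρi y)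
    -- (ii): `∂T/∂θᵢ(x,θ) = ∂F/∂θᵢ(x,θ)/ρ*(T(x,θ))`
    (hii : ∀ x ∈ Set.Icc a b,
      HasDerivAt (fun s => T x (Function.update θ i s)) (Ti x) (θ i) ∧
      Ti x = Fi x / ρs (T x θ))
    -- (iii): `T(·,θ)` is differentiable in `x` with `ρ*(T(x,θ))·∂ₓT(x,θ) = ρ(x,θ)`
    (hiii : ∀ x ∈ Set.Icc a b,
      HasDerivWithinAt (fun y => T y θ) (Tx x) (Set.Icc a b) x ∧
      ρs (T x θ) * Tx x = ρ x θ)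
    -- (iv): differentiation under the integral sign is valid
    (hiv : HasDerivAt (fun s => R (Function.update θ i s))
      (∫ x in a..b, (-(x - T x θ) * Ti x * ρ x θ + (1/2) * (x - T x θ)^2 * ρi x))
      (θ i)) :
    HasDerivAt (fun s => R (Function.update θ i s))
      (-∫ x in a..b, (x - T x θ) * Fi x) (θ i) := by
  have hIcc : Set.uIcc a b = Set.Icc a b := Set.uIcc_of_le hab.le
  have hρθ : ContinuousOn (fun x => ρ x θ) (Set.Icc a b) :=
    hρc.comp (f := fun x => (x, θ)) (by fun_prop) fun x hx => ⟨hx, hθ⟩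
  have hFmem : ∀ x ∈ Set.Icc a b, F x θ ∈ Set.Icc (0 : ℝ) 1 := by
    intro x hx
    have hax : IntervalIntegrable (fun y => ρ y θ) volume a x :=
      (hρθ.mono (by rw [Set.uIcc_of_le hx.1]; exact Set.Icc_subset_Icc_right hx.2)).intervalIntegrable
    have hxb : IntervalIntegrable (fun y => ρ y θ) volume x b :=
      (hρθ.mono (by rw [Set.uIcc_of_le hx.2]; exact Set.Icc_subset_Icc_left hx.1)).intervalIntegrable
    have hadd := intervalIntegral.integral_add_adjacent_intervals hax hxb
    have h0 : 0 ≤ ∫ y in a..x, ρ y θ := intervalIntegral.integral_nonneg hx.1 fun y hy =>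
      (hρpos θ hθ y ⟨hy.1, hy.2.trans hx.2⟩).le
    have h1 : 0 ≤ ∫ y in x..b, ρ y θ := intervalIntegral.integral_nonneg hx.2 fun y hy =>
      (hρpos θ hθ y ⟨hx.1.trans hy.1, hy.2⟩).le
    rw [hρ1 θ hθ] at hadd
    rw [hF]
    exact ⟨h0, by linarith⟩
  have hTmem : ∀ x ∈ Set.Icc a b, T x θ ∈ Set.Icc a b := fun x hx => by
    rw [hT]
    exact invFunOn_primitive_mem_Icc hab.le (hρsc.mono hIcc.subset).intervalIntegrable hρs1 hFs
      (hFmem x hx)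
  have hTc : ContinuousOn (fun x => T x θ) (Set.Icc a b) :=
    fun x hx => (hiii x hx).1.continuousWithinAt
  have hρsT : ∀ x ∈ Set.Icc a b, ρs (T x θ) ≠ 0 := fun x hx => (hρspos _ (hTmem x hx)).ne'
  have hTxc : ContinuousOn Tx (Set.Icc a b) :=
    (hρθ.div (hρsc.comp hTc hTmem) hρsT).congr fun x hx =>
      (eq_div_iff (hρsT x hx)).2 (by rw [mul_comm]; exact (hiii x hx).2)
  have hFib : Fi b = 0 := by
    have hmem : ∀ᶠ s in nhds (θ i), Function.update θ i s ∈ Θ :=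
      (continuous_const.update i continuous_id).continuousAt.eventually_mem
        (hΘ.mem_nhds (by simpa using hθ))
    have hconst : (fun s => F b (Function.update θ i s)) =ᶠ[nhds (θ i)] fun _ => 1 := by
      filter_upwards [hmem] with s hs
      rw [hF, hρ1 _ hs]
    exact (hi b ⟨hab.le, le_rfl⟩).2.1.unique
      ((hasDerivAt_const (θ i) (1 : ℝ)).congr_of_eventuallyEq hconst)
  have hFiEq : ∀ x ∈ Set.Icc a b, Fi x = ∫ y in a..x, ρi y := fun x hx => (hi x hx).2.2
  have hFic : ContinuousOn Fi (Set.Icc a b) :=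
    (hIcc ▸ intervalIntegral.continuousOn_primitive_interval' hρiInt Set.left_mem_uIcc).congr hFiEq
  have hcost : ∀ x ∈ Set.Icc a b, HasDerivWithinAt (fun x => (1/2) * (x - T x θ)^2)
      ((x - T x θ) * (1 - Tx x)) (Set.Icc a b) x := fun x hx => by
    refine ((((hasDerivWithinAt_id x _).sub (hiii x hx).1).pow 2).const_mul (1/2)).congr_deriv ?_
    simp
    ring
  have hdispc : ContinuousOn (fun x => x - T x θ) (Set.Icc a b) := continuousOn_id.sub hTc
  have hcost'c : ContinuousOn (fun x => (x - T x θ) * (1 - Tx x)) (Set.Icc a b) :=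
    hdispc.mul (continuousOn_const.sub hTxc)
  have hparts := integral_mul_eq_sub_integral_deriv_mul_primitive hab.le hcost
    (hcost'c.mono hIcc.subset).intervalIntegrable hρiInt
  rw [← hFiEq b ⟨hab.le, le_rfl⟩, hFib, mul_zero, zero_sub] at hparts
  have hcongr : ∫ x in a..b, (x - T x θ) * (1 - Tx x) * (∫ y in a..x, ρi y) =
      ∫ x in a..b, (x - T x θ) * (1 - Tx x) * Fi x :=
    intervalIntegral.integral_congr fun x hx => by simp only [hFiEq x (hIcc ▸ hx)]
  have htransport : ∫ x in a..b, (-(x - T x θ) * Ti x * ρ x θ + (1/2) * (x - T x θ)^2 * ρi x) =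
      ∫ x in a..b, ((1/2) * (x - T x θ)^2 * ρi x - (x - T x θ) * Tx x * Fi x) :=
    intervalIntegral.integral_congr fun x hx => by
      have hx' : x ∈ Set.Icc a b := hIcc ▸ hx
      have hne := hρsT x hx'
      simp only [(hii x hx').2, ← (hiii x hx').2]
      field_simp
      ring
  have hTxFi : IntervalIntegrable (fun x => (x - T x θ) * Tx x * Fi x) volume a b :=
    (((hdispc.mul hTxc).mul hFic).mono hIcc.subset).intervalIntegrable
  have hcost'Fi : IntervalIntegrable (fun x => (x - T x θ) * (1 - Tx x) * Fi x) volume a b :=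
    ((hcost'c.mul hFic).mono hIcc.subset).intervalIntegrable
  have hcostc : ContinuousOn (fun x => (1/2) * (x - T x θ)^2) (Set.uIcc a b) :=
    hIcc ▸ fun x hx => (hcost x hx).continuousWithinAt
  refine hiv.congr_deriv ?_
  rw [htransport, intervalIntegral.integral_sub (hρiInt.continuousOn_mul hcostc) hTxFi, hparts,
    hcongr, sub_eq_add_neg, ← neg_add, ← intervalIntegral.integral_add hcost'Fi hTxFi]
  congr 2 with x
  ring
end

section
/- Let [a,b] be a compact interval and Θ ⊂ ℝ^d open. Let ρ : [a,b] × Θ → ℝ be continuous, with ρ(·,θ) strictly positive and ∫_a^b ρ(x,θ) dx = 1 for each θ, and set F(x,θ) := ∫_a^x ρ(y,θ) dy. Suppose θ* ∈ Θ and the target density is ρ* := ρ(·,θ*), with cumulative distribution function F* = F(·,θ*), and define T(x,θ) := (F*)⁻¹(F(x,θ)) and R(θ) := (1/2)∫_a^b (x − T(x,θ))² ρ(x,θ) dx. Assume the Hessian formula ∂²R/∂θ_j∂θ_i(θ*) = ∫_a^b (T(x,θ*) − x) ∂²F/∂θ_i∂θ_j(x,θ*) dx + ∫_a^b (∂T/∂x(x,θ*)/ρ(x,θ*))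 ∂F/∂θ_i(x,θ*) ∂F/∂θ_j(x,θ*) dx holds. Then T(x,θ*) = x and ∂T/∂x(x,θ*) = 1 for all x ∈ [a,b], and consequently ∂²R/∂θ_j∂θ_i(θ*) = ∫_a^b (1/ρ(x,θ*)) ∂F/∂θ_i(x,θ*) ∂F/∂θ_j(x,θ*) dx for all i, j; that is, the Hessian of R at θ* equals the Wasserstein metric tensor G_W(θ*) = ∫ (1/ρ(x,θ*)) (∇_θ F(x,θ*))^T ∇_θ F(x,θ*) dx. -/
open MeasureTheory

/-- The primitive of a continuous, strictly positive function on `[a, b]` is strictly increasing. -/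
theorem strictMonoOn_integral_of_pos {f : ℝ → ℝ} {a b : ℝ}
    (hf : ContinuousOn f (Set.Icc a b)) (hpos : ∀ x ∈ Set.Icc a b, 0 < f x) :
    StrictMonoOn (fun x => ∫ y in a..x, f y) (Set.Icc a b) := by
  intro x hx y hy hxy
  have hint : ∀ {u v : ℝ}, u ∈ Set.Icc a b → v ∈ Set.Icc a b → IntervalIntegrable f volume u v :=
    fun hu hv => (hf.mono (Set.uIcc_subset_Icc hu hv)).intervalIntegrable
  have ha : a ∈ Set.Icc a b := ⟨le_rfl, hx.1.trans hx.2⟩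
  have hsub : (∫ t in a..y, f t) - ∫ t in a..x, f t = ∫ t in x..y, f t :=
    intervalIntegral.integral_interval_sub_left (hint ha hy) (hint ha hx)
  have hxy_pos : 0 < ∫ t in x..y, f t :=
    intervalIntegral.intervalIntegral_pos_of_pos_on (hint hx hy)
      (fun t ht => hpos t ⟨hx.1.trans ht.1.le, ht.2.le.trans hy.2⟩) hxy
  show (∫ t in a..x, f t) < ∫ t in a..y, f t
  linarith

/-- Asymptotic Newton property: when the target density is `ρ* = ρ(·,θ*)` (so
`F* = F(·,θ*)` and `T(·,θ*) = id`), the Hessian of the squared-Wasserstein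
objective `R` at `θ*` equals the Wasserstein metric tensor
`G_W(θ*) = ∫ (1/ρ) ∂F/∂θᵢ ∂F/∂θⱼ dx`. -/
theorem stmt13 {d : ℕ} (a b : ℝ) (hab : a < b)
    (Θ : Set (Fin d → ℝ)) (hΘ : IsOpen Θ)
    (ρ : ℝ → (Fin d → ℝ) → ℝ)
    (hρc : ContinuousOn (fun p : ℝ × (Fin d → ℝ) => ρ p.1 p.2) (Set.Icc a b ×ˢ Θ))
    (hρpos : ∀ θ ∈ Θ, ∀ x ∈ Set.Icc a b, 0 < ρ x θ)
    (hρ1 : ∀ θ ∈ Θ, ∫ x in a..b, ρ x θ = 1)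
    (θstar : Fin d → ℝ) (hθstar : θstar ∈ Θ)
    (F : ℝ → (Fin d → ℝ) → ℝ) (hF : ∀ x θ, F x θ = ∫ y in a..x, ρ y θ)
    (T : ℝ → (Fin d → ℝ) → ℝ)
    (hT : ∀ x θ, T x θ
      = Function.invFunOn (fun y => F y θstar) (Set.Icc a b) (F x θ))
    (R : (Fin d → ℝ) → ℝ)
    (hR : ∀ θ, R θ = (1/2) * ∫ x in a..b, (x - T x θ)^2 * ρ x θ)
    (i j : Fin d) (Fi Fj Fij Tx : ℝ → ℝ) (Hij : ℝ)
    (hTx : ∀ x ∈ Set.Icc a b,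
      HasDerivWithinAt (fun y => T y θstar) (Tx x) (Set.Icc a b) x)
    -- the Hessian formula at `θ*`
    (hHess : Hij = (∫ x in a..b, (T x θstar - x) * Fij x)
        + ∫ x in a..b, (Tx x / ρ x θstar) * Fi x * Fj x) :
    (∀ x ∈ Set.Icc a b, T x θstar = x ∧ Tx x = 1) ∧
      Hij = ∫ x in a..b, (1 / ρ x θstar) * Fi x * Fj x := by
  have hρstar : ContinuousOn (fun x => ρ x θstar) (Set.Icc a b) :=
    hρc.comp (f := fun x => (x, θstar)) (by fun_prop) fun x hx => ⟨hx, hθstar⟩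
  have hinj : Set.InjOn (fun y => F y θstar) (Set.Icc a b) := by
    simp only [hF]
    exact (strictMonoOn_integral_of_pos hρstar (hρpos θstar hθstar)).injOn
  have hTid : ∀ x ∈ Set.Icc a b, T x θstar = x := fun x hx => by
    rw [hT]
    exact hinj.leftInvOn_invFunOn hx
  have hTx1 : ∀ x ∈ Set.Icc a b, Tx x = 1 := fun x hx =>
    (uniqueDiffOn_Icc hab x hx).eq_deriv _ (hTx x hx)
      ((hasDerivWithinAt_id x _).congr hTid (hTid x hx))
  refine ⟨fun x hx => ⟨hTid x hx, hTx1 x hx⟩, ?_⟩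
  have hzero : ∫ x in a..b, (T x θstar - x) * Fij x = ∫ _ in a..b, (0 : ℝ) :=
    intervalIntegral.integral_congr fun x hx => by
      rw [Set.uIcc_of_le hab.le] at hx
      simp [hTid x hx]
  rw [hHess, hzero, intervalIntegral.integral_zero, zero_add]
  refine intervalIntegral.integral_congr fun x hx => ?_
  rw [Set.uIcc_of_le hab.le] at hx
  simp only [hTx1 x hx]
end

section
/- Let μ ∈ ℝ and σ > 0, and let ρ(x) := (1/(σ√(2π))) exp(−(x−μ)²/(2σ²)) be the Gaussian density. Let m, v ∈ ℝ and set s := v/(2σ²), φ(x) := s(x−μ) + m. Then for every x ∈ ℝ, −(d/dx)[ρ(x)φ(x)] = m·∂ρ/∂μ(x) + v·∂ρ/∂(σ²)(x), where ∂ρ/∂μ(x) = ρ(x)(x−μ)/σ² is the partial derivative of the Gaussian density with respect to the mean and ∂ρ/∂(σ²)(x) = ρ(x)(−1/(2σ²) + (x−μ)²/(2σ⁴)) is its partial derivative with respect to the variance. -/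
/-- In the 1D Gaussian family parameterized by `(μ, σ²)`, with `s = v/(2σ²)` and
`φ(x) = s(x−μ) + m`, one has `−(ρφ)'(x) = m·∂ρ/∂μ(x) + v·∂ρ/∂σ²(x)`, where
`∂ρ/∂μ(x) = ρ(x)(x−μ)/σ²` and `∂ρ/∂σ²(x) = ρ(x)(−1/(2σ²) + (x−μ)²/(2σ⁴))`. -/
theorem stmt14 (μ σ m v : ℝ) (hσ : 0 < σ) :
    let ρ : ℝ → ℝ := fun x =>
      (1 / (σ * Real.sqrt (2 * Real.pi))) * Real.exp (-(x - μ)^2 / (2 * σ^2))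
    let s : ℝ := v / (2 * σ^2)
    let φ : ℝ → ℝ := fun x => s * (x - μ) + m
    ∀ x : ℝ, HasDerivAt (fun y => ρ y * φ y)
      (-(m * (ρ x * (x - μ) / σ^2)
        + v * (ρ x * (-1 / (2 * σ^2) + (x - μ)^2 / (2 * σ^4))))) x := by
  intro ρ s φ x
  have hx : HasDerivAt (fun y => y - μ) 1 x := (hasDerivAt_id x).sub_const μ
  have hρ : HasDerivAt ρ (-(ρ x * (x - μ) / σ ^ 2)) x := by
    refine ((((hx.fun_pow 2).fun_neg.div_const (2 * σ ^ 2)).exp).const_mul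
      (1 / (σ * Real.sqrt (2 * Real.pi)))).congr_deriv ?_
    simp only [ρ]
    field_simp
    norm_num
  have hφ : HasDerivAt φ s x := ((hx.const_mul s).add_const m).congr_deriv (mul_one s)
  refine (hρ.fun_mul hφ).congr_deriv ?_
  simp only [φ, s]
  field_simp
  ring
end
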